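/- arXiv:2504.14802 — 12 statements merged into one kernel-verified Lean document; each statement's English description precedes it below -/
import Mathlib

section
/- AR-RPC one-node addition preserves quorum overlap: let C_old be a finite set, let x ∉ C_old, and let C_new = C_old ∪ {x}. Then every majority quorum of C_old intersects every majority quorum of C_new. -/
/-- AR-RPC one-node addition preserves quorum overlap: if `x ∉ C_old` and
`C_new = C_old ∪ {x}`, then every majority quorum of `C_old` intersects every
majority quorum of `C_new`. -/
theorem add_one_node_quorum_overlap {α : Type*} [DecidableEq α]
    (Cold : Finset α) (x : α) (hx : x ∉ Cold)
    (Cnew : Finset α) (hCnew : Cnew = Cold ∪ {x})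
    (S T : Finset α) (hS : S ⊆ Cold) (hT : T ⊆ Cnew)
    (hScard : Cold.card / 2 + 1 ≤ S.card) (hTcard : Cnew.card / 2 + 1 ≤ T.card) :
    (S ∩ T).Nonempty := by
  have hcard : Cnew.card = Cold.card + 1 := by
    rw [hCnew, Finset.card_union_of_disjoint (Finset.disjoint_singleton_right.mpr hx),
      Finset.card_singleton]
  have hSnew : S ⊆ Cnew := hCnew ▸ hS.trans Finset.subset_union_left
  exact Finset.inter_nonempty_of_card_lt_card_add_card hSnew hT (by omega)
end

section
/- AR-RPC one-node removal preserves quorum overlap: let C_old be a finite set, let x ∈ C_old, and let C_new = C_old \ {x}. Then every majority quorum of C_old intersects every majority quorum of C_new. -/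
/-- AR-RPC one-node removal preserves quorum overlap: if `x ∈ C_old` and
`C_new = C_old \ {x}`, then every majority quorum of `C_old` intersects every
majority quorum of `C_new`. -/
theorem remove_one_node_quorum_overlap {α : Type*} [DecidableEq α]
    (Cold : Finset α) (x : α) (hx : x ∈ Cold)
    (Cnew : Finset α) (hCnew : Cnew = Cold \ {x})
    (S T : Finset α) (hS : S ⊆ Cold) (hT : T ⊆ Cnew)
    (hScard : Cold.card / 2 + 1 ≤ S.card) (hTcard : Cnew.card / 2 + 1 ≤ T.card) :
    (S ∩ T).Nonempty := by
  subst hCnew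
  refine Finset.inter_nonempty_of_card_lt_card_add_card hS (hT.trans Finset.sdiff_subset) ?_
  rw [Finset.sdiff_singleton_eq_erase, Finset.card_erase_of_mem hx] at hTcard
  omega
end

section
/- AddAndResize quorum overlap: let C_old ⊆ C_new be finite sets with N_old = |C_old|, N_new = |C_new|, and Q_old = ⌊N_old/2⌋ + 1. Then every subset S ⊆ C_new with |S| ≥ N_new − Q_old + 1 intersects every subset T ⊆ C_old with |T| ≥ Q_old. -/
/-- AddAndResize quorum overlap: with `C_old ⊆ C_new`, `Q_old = ⌊|C_old|/2⌋ + 1`,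
every subset `S ⊆ C_new` with `|S| ≥ |C_new| − Q_old + 1` intersects every subset
`T ⊆ C_old` with `|T| ≥ Q_old`. -/
theorem addAndResize_quorum_overlap {α : Type*} [DecidableEq α]
    (Cold Cnew : Finset α) (hsub : Cold ⊆ Cnew)
    (S T : Finset α) (hS : S ⊆ Cnew) (hT : T ⊆ Cold)
    (hScard : Cnew.card - (Cold.card / 2 + 1) + 1 ≤ S.card)
    (hTcard : Cold.card / 2 + 1 ≤ T.card) :
    (S ∩ T).Nonempty := by
  exact Finset.inter_nonempty_of_card_lt_card_add_card hS (hT.trans hsub) (by lia)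
end

section
/- Minimality of the AddAndResize quorum size: let C_old ⊆ C_new be finite sets with C_old nonempty, let Q_old = ⌊|C_old|/2⌋ + 1, and let q be a natural number with q + Q_old ≤ |C_new|. Then there exist disjoint subsets S ⊆ C_new and T ⊆ C_old with |S| = q and |T| = Q_old. -/
/-- Minimality of the AddAndResize quorum size: with `C_old ⊆ C_new`, `C_old`
nonempty, `Q_old = ⌊|C_old|/2⌋ + 1`, and `q + Q_old ≤ |C_new|`, there are disjoint
subsets `S ⊆ C_new` and `T ⊆ C_old` with `|S| = q` and `|T| = Q_old`. -/
theorem addAndResize_quorum_minimality {α : Type*} [DecidableEq α]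
    (Cold Cnew : Finset α) (hsub : Cold ⊆ Cnew) (hne : Cold.Nonempty)
    (q : ℕ) (hq : q + (Cold.card / 2 + 1) ≤ Cnew.card) :
    ∃ S T : Finset α, S ⊆ Cnew ∧ T ⊆ Cold ∧ Disjoint S T ∧
      S.card = q ∧ T.card = Cold.card / 2 + 1 := by
  have hpos := hne.card_pos
  obtain ⟨T, hT, hTcard⟩ :=
    Finset.exists_subset_card_eq (show Cold.card / 2 + 1 ≤ Cold.card by omega)
  have hcard : q ≤ (Cnew \ T).card := by
    rw [Finset.card_sdiff_of_subset (hT.trans hsub), hTcard]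
    omega
  obtain ⟨S, hS, hScard⟩ := Finset.exists_subset_card_eq hcard
  exact ⟨S, T, hS.trans Finset.sdiff_subset, hT,
    Finset.disjoint_of_subset_left hS Finset.sdiff_disjoint, hScard, hTcard⟩
end

section
/- ResizeQuorum safety after adding nodes: let C_old ⊆ C_new be finite sets with Q_old = ⌊|C_old|/2⌋ + 1 and N_new = |C_new|. Then every subset S ⊆ C_new with |S| ≥ N_new − Q_old + 1 intersects every majority quorum of C_new. -/
/-- ResizeQuorum safety after adding nodes: with `C_old ⊆ C_new` and
`Q_old = ⌊|C_old|/2⌋ + 1`, every subset `S ⊆ C_new` with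
`|S| ≥ |C_new| − Q_old + 1` intersects every majority quorum of `C_new`. -/
theorem resizeQuorum_safety_add {α : Type*} [DecidableEq α]
    (Cold Cnew : Finset α) (hsub : Cold ⊆ Cnew)
    (S T : Finset α) (hS : S ⊆ Cnew) (hT : T ⊆ Cnew)
    (hScard : Cnew.card - (Cold.card / 2 + 1) + 1 ≤ S.card)
    (hTcard : Cnew.card / 2 + 1 ≤ T.card) :
    (S ∩ T).Nonempty := by
  have hC := Finset.card_le_card hsub
  exact Finset.inter_nonempty_of_card_lt_card_add_card hS hT (by omega)
end

section
/- RemoveAndResize overlap with old majorities: let C_new ⊆ C_old be finite sets with N_old = |C_old| and Q_new = ⌊|C_new|/2⌋ + 1. Then every subset S ⊆ C_new with |S| ≥ N_old − Q_new + 1 intersects every subset T ⊆ C_old with |T| ≥ ⌊N_old/2⌋ + 1. -/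
/-- RemoveAndResize overlap with old majorities: with `C_new ⊆ C_old` and
`Q_new = ⌊|C_new|/2⌋ + 1`, every subset `S ⊆ C_new` with
`|S| ≥ |C_old| − Q_new + 1` intersects every subset `T ⊆ C_old`
with `|T| ≥ ⌊|C_old|/2⌋ + 1`. -/
theorem removeAndResize_overlap_old {α : Type*} [DecidableEq α]
    (Cold Cnew : Finset α) (hsub : Cnew ⊆ Cold)
    (S T : Finset α) (hS : S ⊆ Cnew) (hT : T ⊆ Cold)
    (hScard : Cold.card - (Cnew.card / 2 + 1) + 1 ≤ S.card)
    (hTcard : Cold.card / 2 + 1 ≤ T.card) :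
    (S ∩ T).Nonempty := by
  have hle := Finset.card_le_card hsub
  exact Finset.inter_nonempty_of_card_lt_card_add_card (hS.trans hsub) hT (by omega)
end

section
/- RemoveAndResize overlap with new majorities: let C_new ⊆ C_old be finite sets with N_old = |C_old| and Q_new = ⌊|C_new|/2⌋ + 1. Then every subset S ⊆ C_new with |S| ≥ N_old − Q_new + 1 intersects every subset T ⊆ C_new with |T| ≥ Q_new. -/
/-- RemoveAndResize overlap with new majorities: with `C_new ⊆ C_old` and
`Q_new = ⌊|C_new|/2⌋ + 1`, every subset `S ⊆ C_new` with
`|S| ≥ |C_old| − Q_new + 1` intersects every subset `T ⊆ C_new`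
with `|T| ≥ Q_new`. -/
theorem removeAndResize_overlap_new {α : Type*} [DecidableEq α]
    (Cold Cnew : Finset α) (hsub : Cnew ⊆ Cold)
    (S T : Finset α) (hS : S ⊆ Cnew) (hT : T ⊆ Cnew)
    (hScard : Cold.card - (Cnew.card / 2 + 1) + 1 ≤ S.card)
    (hTcard : Cnew.card / 2 + 1 ≤ T.card) :
    (S ∩ T).Nonempty := by
  have hle := Finset.card_le_card hsub
  have hunion := Finset.card_le_card (Finset.union_subset hS hT)
  have hadd := Finset.card_union_add_card_inter S T
  rw [← Finset.card_pos]
  omega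
end

section
/- Split joint quorums overlap old majority quorums: let C be a finite set partitioned into pairwise disjoint nonempty finite sets C_1, …, C_k (k ≥ 1) whose union is C. If S ⊆ C satisfies |S ∩ C_i| ≥ ⌊|C_i|/2⌋ + 1 for every i, and T ⊆ C satisfies |T| ≥ ⌊|C|/2⌋ + 1, then S ∩ T is nonempty. -/
/-- Split joint quorums overlap old majority quorums: let `C` be partitioned into
pairwise disjoint nonempty subclusters `Csub 0, …, Csub (k-1)` (`k ≥ 1`) whose
union is `C`.  If `S ⊆ C` contains a majority of every subcluster and `T ⊆ C` is
a majority quorum of `C`, then `S ∩ T` is nonempty. -/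
theorem split_joint_overlaps_old_majority {α : Type*} [DecidableEq α]
    (k : ℕ) (hk : 1 ≤ k) (Csub : Fin k → Finset α)
    (hne : ∀ i, (Csub i).Nonempty)
    (hdisj : ∀ i j, i ≠ j → Disjoint (Csub i) (Csub j))
    (C : Finset α) (hunion : Finset.univ.biUnion Csub = C)
    (S T : Finset α) (hS : S ⊆ C) (hT : T ⊆ C)
    (hSmaj : ∀ i, (Csub i).card / 2 + 1 ≤ (S ∩ Csub i).card)
    (hTmaj : C.card / 2 + 1 ≤ T.card) :
    (S ∩ T).Nonempty := by
  have hC : C.card = ∑ i, (Csub i).card := by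
    rw [← hunion, Finset.card_biUnion fun i _ j _ hij => hdisj i j hij]
  have hScard : S.card = ∑ i, (S ∩ Csub i).card := by
    rw [← Finset.card_biUnion fun i _ j _ hij =>
      (hdisj i j hij).mono Finset.inter_subset_right Finset.inter_subset_right,
      ← Finset.inter_biUnion, hunion, Finset.inter_eq_left.mpr hS]
  have hhalf : C.card ≤ 2 * S.card := by
    rw [hC, hScard, Finset.mul_sum]
    exact Finset.sum_le_sum fun i _ => by have := hSmaj i; omega
  exact Finset.inter_nonempty_of_card_lt_card_add_card hS hT (by omega)
end

section
/- Two joint quorums of the same split intersect: let C be a finite set partitioned into pairwise disjoint nonempty finite sets C_1, …, C_k (k ≥ 1) whose union is C. If S ⊆ C and S' ⊆ C each satisfy |S ∩ C_i| ≥ ⌊|C_i|/2⌋ + 1 and |S' ∩ C_i| ≥ ⌊|C_i|/2⌋ + 1 for every i, then S ∩ S' is nonempty. -/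
/-- Two joint quorums of the same split intersect: let `C` be partitioned into
pairwise disjoint nonempty subclusters `Csub 0, …, Csub (k-1)` (`k ≥ 1`) whose
union is `C`.  If `S ⊆ C` and `S' ⊆ C` each contain a majority of every
subcluster, then `S ∩ S'` is nonempty. -/
theorem split_joint_quorums_intersect {α : Type*} [DecidableEq α]
    (k : ℕ) (hk : 1 ≤ k) (Csub : Fin k → Finset α)
    (hne : ∀ i, (Csub i).Nonempty)
    (hdisj : ∀ i j, i ≠ j → Disjoint (Csub i) (Csub j))
    (C : Finset α) (hunion : Finset.univ.biUnion Csub = C)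
    (S S' : Finset α) (hS : S ⊆ C) (hS' : S' ⊆ C)
    (hSmaj : ∀ i, (Csub i).card / 2 + 1 ≤ (S ∩ Csub i).card)
    (hS'maj : ∀ i, (Csub i).card / 2 + 1 ≤ (S' ∩ Csub i).card) :
    (S ∩ S').Nonempty := by
  have hcard := hSmaj ⟨0, hk⟩
  have hcard' := hS'maj ⟨0, hk⟩
  have hinter := Finset.inter_nonempty_of_card_lt_card_add_card
    (Finset.inter_subset_right (s₁ := S) (s₂ := Csub ⟨0, hk⟩))
    (Finset.inter_subset_right (s₁ := S') (s₂ := Csub ⟨0, hk⟩)) (by omega)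
  exact hinter.mono (Finset.inter_subset_inter Finset.inter_subset_left Finset.inter_subset_left)
end

section
/- Joint-consensus worst-case vote bound when adding nodes: let C_old ⊆ C_new be finite sets with C_old nonempty, Q_old = ⌊|C_old|/2⌋ + 1, Q_new = ⌊|C_new|/2⌋ + 1. Then every subset S ⊆ C_new with |S| ≥ (|C_new| − |C_old|) + Q_old satisfies both |S ∩ C_old| ≥ Q_old and |S| ≥ Q_new. -/
/-- Joint-consensus worst-case vote bound when adding nodes: with
`C_old ⊆ C_new`, `C_old` nonempty, `Q_old = ⌊|C_old|/2⌋ + 1`,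
`Q_new = ⌊|C_new|/2⌋ + 1`, every subset `S ⊆ C_new` with
`|S| ≥ (|C_new| − |C_old|) + Q_old` satisfies both `|S ∩ C_old| ≥ Q_old` and
`|S| ≥ Q_new`. -/
theorem jc_worst_case_add {α : Type*} [DecidableEq α]
    (Cold Cnew : Finset α) (hsub : Cold ⊆ Cnew) (hne : Cold.Nonempty)
    (S : Finset α) (hS : S ⊆ Cnew)
    (hScard : (Cnew.card - Cold.card) + (Cold.card / 2 + 1) ≤ S.card) :
    Cold.card / 2 + 1 ≤ (S ∩ Cold).card ∧ Cnew.card / 2 + 1 ≤ S.card := by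
  have hcard := Finset.card_le_card hsub
  have hdiff : (S \ Cold).card ≤ Cnew.card - Cold.card :=
    Finset.card_sdiff_of_subset hsub ▸ Finset.card_le_card (Finset.sdiff_subset_sdiff hS subset_rfl)
  have hsplit := Finset.card_inter_add_card_sdiff S Cold
  omega
end

section
/- Joint-consensus worst-case vote bound when removing nodes: let C_new ⊆ C_old be finite sets with C_new nonempty, Q_old = ⌊|C_old|/2⌋ + 1, Q_new = ⌊|C_new|/2⌋ + 1. Then every subset S ⊆ C_old with |S| ≥ (|C_old| − |C_new|) + Q_new satisfies both |S| ≥ Q_old and |S ∩ C_new| ≥ Q_new. -/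
/-- Joint-consensus worst-case vote bound when removing nodes: with
`C_new ⊆ C_old`, `C_new` nonempty, `Q_old = ⌊|C_old|/2⌋ + 1`,
`Q_new = ⌊|C_new|/2⌋ + 1`, every subset `S ⊆ C_old` with
`|S| ≥ (|C_old| − |C_new|) + Q_new` satisfies both `|S| ≥ Q_old` and
`|S ∩ C_new| ≥ Q_new`. -/
theorem jc_worst_case_remove {α : Type*} [DecidableEq α]
    (Cold Cnew : Finset α) (hsub : Cnew ⊆ Cold) (hne : Cnew.Nonempty)
    (S : Finset α) (hS : S ⊆ Cold)
    (hScard : (Cold.card - Cnew.card) + (Cnew.card / 2 + 1) ≤ S.card) :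
    Cold.card / 2 + 1 ≤ S.card ∧ Cnew.card / 2 + 1 ≤ (S ∩ Cnew).card := by
  have hle := Finset.card_le_card hsub
  have hunion := Finset.card_le_card (Finset.union_subset hS hsub)
  have hinter := Finset.card_union_add_card_inter S Cnew
  omega
end

section
/- Joint-consensus best-case vote count when adding nodes: let C_old ⊆ C_new be finite sets with C_old nonempty, Q_old = ⌊|C_old|/2⌋ + 1, Q_new = ⌊|C_new|/2⌋ + 1. Then the minimum cardinality of a subset S ⊆ C_new satisfying |S ∩ C_old| ≥ Q_old and |S| ≥ Q_new is exactly max(Q_old, Q_new); in particular, such a set S of cardinality max(Q_old, Q_new) exists. -/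
/-- Joint-consensus best-case vote count when adding nodes: with
`C_old ⊆ C_new`, `C_old` nonempty, `Q_old = ⌊|C_old|/2⌋ + 1`,
`Q_new = ⌊|C_new|/2⌋ + 1`, the minimum cardinality of a subset `S ⊆ C_new` with
`|S ∩ C_old| ≥ Q_old` and `|S| ≥ Q_new` is exactly `max Q_old Q_new`. -/
theorem jc_best_case_add {α : Type*} [DecidableEq α]
    (Cold Cnew : Finset α) (hsub : Cold ⊆ Cnew) (hne : Cold.Nonempty) :
    IsLeast {m : ℕ | ∃ S : Finset α, S ⊆ Cnew ∧
        Cold.card / 2 + 1 ≤ (S ∩ Cold).card ∧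
        Cnew.card / 2 + 1 ≤ S.card ∧ S.card = m}
      (max (Cold.card / 2 + 1) (Cnew.card / 2 + 1)) := by
  have hpos := hne.card_pos
  have hle := Finset.card_le_card hsub
  constructor
  · obtain ⟨T, hT, hTcard⟩ :=
      Finset.exists_subset_card_eq (s := Cold) (n := Cold.card / 2 + 1) (by omega)
    obtain ⟨S, hTS, hS, hScard⟩ :=
      Finset.exists_subsuperset_card_eq (hT.trans hsub)
        (n := max (Cold.card / 2 + 1) (Cnew.card / 2 + 1)) (by omega) (by omega)
    exact ⟨S, hS, hTcard ▸ Finset.card_le_card (Finset.subset_inter hTS hT),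
      hScard ▸ le_max_right _ _, hScard⟩
  · rintro m ⟨S, -, hold, hnew, rfl⟩
    exact max_le (hold.trans (Finset.card_le_card Finset.inter_subset_left)) hnew
end
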